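/- Let U ⊆ ℝⁿ be open and let ∇ be a torsion-free affine connection on U with curvature R_{ab}^c_d, and assume ∇_a R_{bc}^d_e = 0 on U. Then at every point of U and for all indices a, b, c, d, p, q one has R_{ab}^e_c R_{de}^p_q − R_{ab}^e_d R_{ce}^p_q = R_{ab}^e_q R_{cd}^p_e − R_{cd}^e_q R_{ab}^p_e (summation over e). Consequently R_{ab}^e_c R_{de}^p_q − R_{ab}^e_d R_{ce}^p_q + R_{cd}^e_a R_{be}^p_q − R_{cd}^e_b R_{ae}^p_q = 0; that is, for each fixed p and q, the 2-form (c, d) ↦ R_{cd}^p_q lies in K at every point (R ∈ Γ(K ⊗ End(Λ¹))). -/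

import Mathlib

open scoped BigOperators

noncomputable section

/-- Partial derivative in coordinate direction `a`. -/
def pd {n : ℕ} (a : Fin n) (f : (Fin n → ℝ) → ℝ) (x : Fin n → ℝ) : ℝ :=
  fderiv ℝ f x (Pi.single a 1)

/-- Curvature `R_{ab}ᶜ_d` of the affine connection with Christoffel symbols `Γ`. -/
def curv {n : ℕ} (Γ : Fin n → Fin n → Fin n → (Fin n → ℝ) → ℝ)
    (a b c d : Fin n) (x : Fin n → ℝ) : ℝ :=
  pd a (Γ b d c) x - pd b (Γ a d c) x +
    ∑ e, (Γ b d e x * Γ a e c x - Γ a d e x * Γ b e c x)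

/-- Covariant derivative `∇_a R_{bc}ᵈ_e` of the curvature. -/
def covR {n : ℕ} (Γ : Fin n → Fin n → Fin n → (Fin n → ℝ) → ℝ)
    (a b c d e : Fin n) (x : Fin n → ℝ) : ℝ :=
  pd a (curv Γ b c d e) x - ∑ f, Γ a b f x * curv Γ f c d e x
    - ∑ f, Γ a c f x * curv Γ b f d e x + ∑ f, Γ a f d x * curv Γ b c f e x
    - ∑ f, Γ a e f x * curv Γ b c d f x

/-- Membership of an antisymmetric bilinear form `m` in the space `K_x`. -/
def Kmem {n : ℕ} (Γ : Fin n → Fin n → Fin n → (Fin n → ℝ) → ℝ)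
    (x : Fin n → ℝ) (m : Fin n → Fin n → ℝ) : Prop :=
  (∀ b c, m b c = - m c b) ∧
  ∀ a b c d, ∑ e, (curv Γ a b e c x * m d e - curv Γ a b e d x * m c e
    + curv Γ c d e a x * m b e - curv Γ c d e b x * m a e) = 0

/-- The derivation action of a matrix `A` on tensors `T_{cd}ᵖ_q`. -/
def derivAct {n : ℕ} (A : Matrix (Fin n) (Fin n) ℝ) (T : Fin n → Fin n → Fin n → Fin n → ℝ)
    (c d p q : Fin n) : ℝ :=
  ∑ f, A c f * T f d p q + ∑ f, A d f * T c f p q - ∑ f, A f p * T c d f q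
    + ∑ f, A q f * T c d p f

lemma sum_mul_sum_mul_comm {n : ℕ} (u v : Fin n → ℝ) (t : Fin n → Fin n → ℝ) :
    ∑ f, u f * ∑ g, v g * t f g = ∑ g, v g * ∑ f, u f * t f g := by
  simp only [Finset.mul_sum]
  rw [Finset.sum_comm]
  exact Finset.sum_congr rfl fun _ _ => Finset.sum_congr rfl fun _ _ => by ring

lemma sum_mul_sum_row {n : ℕ} (A B : Matrix (Fin n) (Fin n) ℝ) (c : Fin n) (t : Fin n → ℝ) :
    ∑ f, A c f * ∑ g, B f g * t g = ∑ g, (A * B) c g * t g := by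
  simp only [Finset.mul_sum, Matrix.mul_apply, Finset.sum_mul]
  rw [Finset.sum_comm]
  exact Finset.sum_congr rfl fun _ _ => Finset.sum_congr rfl fun _ _ => by ring

lemma sum_mul_sum_col {n : ℕ} (A B : Matrix (Fin n) (Fin n) ℝ) (p : Fin n) (t : Fin n → ℝ) :
    ∑ f, A f p * ∑ g, B g f * t g = ∑ g, (B * A) g p * t g := by
  simp only [Finset.mul_sum, Matrix.mul_apply, Finset.sum_mul]
  rw [Finset.sum_comm]
  exact Finset.sum_congr rfl fun _ _ => Finset.sum_congr rfl fun _ _ => by ring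

lemma derivAct_add {n : ℕ} (A B : Matrix (Fin n) (Fin n) ℝ)
    (T : Fin n → Fin n → Fin n → Fin n → ℝ) (c d p q : Fin n) :
    derivAct (A + B) T c d p q = derivAct A T c d p q + derivAct B T c d p q := by
  simp only [derivAct, Matrix.add_apply, add_mul, Finset.sum_add_distrib]
  ring

lemma derivAct_sub {n : ℕ} (A B : Matrix (Fin n) (Fin n) ℝ)
    (T : Fin n → Fin n → Fin n → Fin n → ℝ) (c d p q : Fin n) :
    derivAct (A - B) T c d p q = derivAct A T c d p q - derivAct B T c d p q := by
  simp only [derivAct, Matrix.sub_apply, sub_mul, Finset.sum_sub_distrib]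
  ring

lemma derivAct_commutator {n : ℕ} (A B : Matrix (Fin n) (Fin n) ℝ)
    (T : Fin n → Fin n → Fin n → Fin n → ℝ) (c d p q : Fin n) :
    derivAct A (derivAct B T) c d p q - derivAct B (derivAct A T) c d p q
      = derivAct (A * B - B * A) T c d p q := by
  rw [derivAct_sub]
  simp only [derivAct, mul_add, mul_sub, Finset.sum_add_distrib, Finset.sum_sub_distrib,
    sum_mul_sum_row, sum_mul_sum_col A B, sum_mul_sum_col B A]
  rw [sum_mul_sum_mul_comm (A c) (B d) fun f g => T f g p q,
    sum_mul_sum_mul_comm (A c) (fun g => B g p) fun f g => T f d g q,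
    sum_mul_sum_mul_comm (A c) (B q) fun f g => T f d p g,
    sum_mul_sum_mul_comm (A d) (B c) fun f g => T g f p q,
    sum_mul_sum_mul_comm (A d) (fun g => B g p) fun f g => T c f g q,
    sum_mul_sum_mul_comm (A d) (B q) fun f g => T c f p g,
    sum_mul_sum_mul_comm (fun f => A f p) (B c) fun f g => T g d f q,
    sum_mul_sum_mul_comm (fun f => A f p) (B d) fun f g => T c g f q,
    sum_mul_sum_mul_comm (fun f => A f p) (B q) fun f g => T c d f g,
    sum_mul_sum_mul_comm (A q) (B c) fun f g => T g d p f,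
    sum_mul_sum_mul_comm (A q) (B d) fun f g => T c g p f,
    sum_mul_sum_mul_comm (A q) (fun g => B g p) fun f g => T c d g f]
  ring

lemma contDiffOn_pd {n : ℕ} {U : Set (Fin n → ℝ)} (hU : IsOpen U) {f : (Fin n → ℝ) → ℝ}
    (hf : ContDiffOn ℝ (⊤ : ℕ∞) f U) (a : Fin n) : ContDiffOn ℝ (⊤ : ℕ∞) (pd a f) U :=
  (hf.fderiv_of_isOpen hU (by simp)).clm_apply contDiffOn_const

lemma pd_comm {n : ℕ} {U : Set (Fin n → ℝ)} (hU : IsOpen U) {f : (Fin n → ℝ) → ℝ}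
    (hf : ContDiffOn ℝ (⊤ : ℕ∞) f U) {x : Fin n → ℝ} (hx : x ∈ U) (a b : Fin n) :
    pd a (pd b f) x = pd b (pd a f) x := by
  have hd : DifferentiableAt ℝ (fderiv ℝ f) x :=
    ((hf.fderiv_of_isOpen (m := 1) hU (by norm_cast)).contDiffAt
      (hU.mem_nhds hx)).differentiableAt (by simp)
  have hsymm : IsSymmSndFDerivAt ℝ f x :=
    (hf.contDiffAt (hU.mem_nhds hx)).isSymmSndFDerivAt (by
      simp only [minSmoothness_of_isRCLikeNormedField]; exact WithTop.coe_le_coe.2 le_top)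
  have key : ∀ a b : Fin n, pd a (pd b f) x
      = fderiv ℝ (fderiv ℝ f) x (Pi.single a 1) (Pi.single b 1) := fun a b => by
    have := (hd.hasFDerivAt.clm_apply
      (hasFDerivAt_const (Pi.single b (1 : ℝ) : Fin n → ℝ) x)).fderiv
    change fderiv ℝ (fun y => fderiv ℝ f y (Pi.single b 1)) x (Pi.single a 1) = _
    rw [this]
    simp
  rw [key, key]
  exact hsymm _ _

lemma pd_congr {n : ℕ} {U : Set (Fin n → ℝ)} (hU : IsOpen U) {f g : (Fin n → ℝ) → ℝ}
    (h : ∀ y ∈ U, f y = g y) {x : Fin n → ℝ} (hx : x ∈ U) (a : Fin n) :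
    pd a f x = pd a g x := by
  have : f =ᶠ[nhds x] g := Filter.eventually_of_mem (hU.mem_nhds hx) h
  rw [pd, pd, this.fderiv_eq]

lemma pd_sum_mul {n : ℕ} {x : Fin n → ℝ} {f g : Fin n → (Fin n → ℝ) → ℝ}
    (hf : ∀ i, DifferentiableAt ℝ (f i) x) (hg : ∀ i, DifferentiableAt ℝ (g i) x) (a : Fin n) :
    pd a (fun y => ∑ i, f i y * g i y) x
      = ∑ i, pd a (f i) x * g i x + ∑ i, f i x * pd a (g i) x := by
  have := (HasFDerivAt.fun_sum (u := Finset.univ) fun i _ =>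
    (hf i).hasFDerivAt.mul (hg i).hasFDerivAt).fderiv
  simp only [Pi.mul_def] at this
  simp only [pd]
  rw [this]
  simp only [sum_apply, add_apply,
    smul_apply, smul_eq_mul, ← Finset.sum_add_distrib]
  exact Finset.sum_congr rfl fun _ _ => by ring

lemma pd_derivAct {n : ℕ} {x : Fin n → ℝ} {A : Fin n → Fin n → (Fin n → ℝ) → ℝ}
    {T : Fin n → Fin n → Fin n → Fin n → (Fin n → ℝ) → ℝ}
    (hA : ∀ i j, DifferentiableAt ℝ (A i j) x)
    (hT : ∀ i j k l, DifferentiableAt ℝ (T i j k l) x) (b c d p q : Fin n) :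
    pd b (fun y => derivAct (Matrix.of fun i j => A i j y) (fun i j k l => T i j k l y) c d p q) x
      = derivAct (Matrix.of fun i j => pd b (A i j) x) (fun i j k l => T i j k l x) c d p q
        + derivAct (Matrix.of fun i j => A i j x) (fun i j k l => pd b (T i j k l) x) c d p q := by
  have hs : ∀ {f g : Fin n → (Fin n → ℝ) → ℝ}, (∀ i, DifferentiableAt ℝ (f i) x) →
      (∀ i, DifferentiableAt ℝ (g i) x) →
      DifferentiableAt ℝ (fun y => ∑ i, f i y * g i y) x := fun hf hg =>
    DifferentiableAt.fun_sum fun i _ => (hf i).mul (hg i)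
  have h1 := hs (hA c) fun i => hT i d p q
  have h2 := hs (hA d) fun i => hT c i p q
  have h3 := hs (fun i => hA i p) fun i => hT c d i q
  have h4 := hs (hA q) fun i => hT c d p i
  have h := (((h1.hasFDerivAt.add h2.hasFDerivAt).sub h3.hasFDerivAt).add h4.hasFDerivAt).fderiv
  have e1 := pd_sum_mul (hA c) (fun i => hT i d p q) b
  have e2 := pd_sum_mul (hA d) (fun i => hT c i p q) b
  have e3 := pd_sum_mul (fun i => hA i p) (fun i => hT c d i q) b
  have e4 := pd_sum_mul (hA q) (fun i => hT c d p i) b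
  have e := congrArg (fun L => L (Pi.single b (1 : ℝ))) h
  simp only [add_apply, sub_apply] at e
  change pd b (fun y => derivAct (Matrix.of fun i j => A i j y) (fun i j k l => T i j k l y) c d p q) x
    = pd b _ x + pd b _ x - pd b _ x + pd b _ x at e
  rw [e, e1, e2, e3, e4]
  simp only [derivAct, Matrix.of_apply]
  ring

lemma contDiffOn_curv {n : ℕ} {U : Set (Fin n → ℝ)} (hU : IsOpen U)
    {Γ : Fin n → Fin n → Fin n → (Fin n → ℝ) → ℝ}
    (hΓ : ∀ a b c, ContDiffOn ℝ (⊤ : ℕ∞) (Γ a b c) U) (a b c d : Fin n) :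
    ContDiffOn ℝ (⊤ : ℕ∞) (curv Γ a b c d) U :=
  ((contDiffOn_pd hU (hΓ _ _ _) _).sub (contDiffOn_pd hU (hΓ _ _ _) _)).add
    (ContDiffOn.sum fun _ _ => ((hΓ _ _ _).mul (hΓ _ _ _)).sub ((hΓ _ _ _).mul (hΓ _ _ _)))

lemma curv_antisymm {n : ℕ} (Γ : Fin n → Fin n → Fin n → (Fin n → ℝ) → ℝ) (a b c d : Fin n)
    (x : Fin n → ℝ) : curv Γ a b c d x = - curv Γ b a c d x := by
  simp only [curv, Finset.sum_sub_distrib]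
  ring

/-- The Ricci identity for the curvature of a locally symmetric connection. -/
lemma derivAct_curv_curv_eq_zero {n : ℕ} {U : Set (Fin n → ℝ)} (hU : IsOpen U)
    {Γ : Fin n → Fin n → Fin n → (Fin n → ℝ) → ℝ}
    (hΓ : ∀ a b c, ContDiffOn ℝ (⊤ : ℕ∞) (Γ a b c) U)
    (hloc : ∀ a b c d e, ∀ x ∈ U, covR Γ a b c d e x = 0) {x : Fin n → ℝ} (hx : x ∈ U)
    (a b c d p q : Fin n) :
    derivAct (Matrix.of fun i j => curv Γ a b j i x) (fun i j k l => curv Γ i j k l x) c d p q = 0 := by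
  have hpd : ∀ a c d p q, ∀ y ∈ U, pd a (curv Γ c d p q) y
      = derivAct (Matrix.of fun i j => Γ a i j y) (fun i j k l => curv Γ i j k l y) c d p q := by
    intro a c d p q y hy
    have := hloc a c d p q y hy
    simp only [covR] at this
    simp only [derivAct, Matrix.of_apply]
    linarith
  have hdiff : ∀ {f : (Fin n → ℝ) → ℝ}, ContDiffOn ℝ (⊤ : ℕ∞) f U → DifferentiableAt ℝ f x :=
    fun hf => (hf.contDiffAt (hU.mem_nhds hx)).differentiableAt (by simp)
  have hpd2 : ∀ a b, pd b (pd a (curv Γ c d p q)) x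
      = derivAct (Matrix.of fun i j => pd b (Γ a i j) x) (fun i j k l => curv Γ i j k l x) c d p q
        + derivAct (Matrix.of fun i j => Γ a i j x)
            (derivAct (Matrix.of fun i j => Γ b i j x) fun i j k l => curv Γ i j k l x) c d p q := by
    intro a b
    rw [pd_congr hU (hpd a c d p q) hx, pd_derivAct (fun i j => hdiff (hΓ a i j))
      fun i j k l => hdiff (contDiffOn_curv hU hΓ i j k l)]
    congr 2
    funext i j k l
    exact hpd b i j k l x hx
  have hcomm := pd_comm hU (contDiffOn_curv hU hΓ c d p q) hx a b
  rw [hpd2, hpd2] at hcomm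
  have hbr := derivAct_commutator (Matrix.of fun i j => Γ b i j x) (Matrix.of fun i j => Γ a i j x)
    (fun i j k l => curv Γ i j k l x) c d p q
  have hcurv : (Matrix.of fun i j => curv Γ a b j i x)
      = Matrix.of (fun i j => pd a (Γ b i j) x) - Matrix.of (fun i j => pd b (Γ a i j) x)
        + (Matrix.of (fun i j => Γ b i j x) * Matrix.of (fun i j => Γ a i j x)
          - Matrix.of (fun i j => Γ a i j x) * Matrix.of fun i j => Γ b i j x) := by
    ext i j
    simp only [curv, Matrix.add_apply, Matrix.sub_apply, Matrix.mul_apply, Matrix.of_apply,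
      Finset.sum_sub_distrib]
  rw [hcurv, derivAct_add, derivAct_sub, ← hbr]
  linarith

/-- **Curvature of a locally symmetric connection lies in `Γ(K ⊗ End Λ¹)`.**
If `∇_a R_{bc}ᵈ_e = 0` then `R_{ab}ᵉ_c R_{de}ᵖ_q − R_{ab}ᵉ_d R_{ce}ᵖ_q
= R_{ab}ᵉ_q R_{cd}ᵖ_e − R_{cd}ᵉ_q R_{ab}ᵖ_e`, and consequently, for each fixed
`p, q`, the 2-form `(c,d) ↦ R_{cd}ᵖ_q` lies in `K` at every point. -/
theorem curvature_in_K_tensor_End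
    {n : ℕ} (hn : 1 ≤ n) (U : Set (Fin n → ℝ)) (hU : IsOpen U)
    (Γ : Fin n → Fin n → Fin n → (Fin n → ℝ) → ℝ)
    (hΓsmooth : ∀ a b c, ContDiffOn ℝ (⊤ : ℕ∞) (Γ a b c) U)
    (hΓsym : ∀ a b c, ∀ x ∈ U, Γ a b c x = Γ b a c x)
    (hlocsym : ∀ a b c d e, ∀ x ∈ U, covR Γ a b c d e x = 0) :
    ∀ x ∈ U, ∀ a b c d p q : Fin n,
      (∑ e, (curv Γ a b e c x * curv Γ d e p q x -
             curv Γ a b e d x * curv Γ c e p q x)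
        = ∑ e, (curv Γ a b e q x * curv Γ c d p e x -
                curv Γ c d e q x * curv Γ a b p e x)) ∧
      (∑ e, (curv Γ a b e c x * curv Γ d e p q x -
             curv Γ a b e d x * curv Γ c e p q x +
             curv Γ c d e a x * curv Γ b e p q x -
             curv Γ c d e b x * curv Γ a e p q x) = 0) ∧
      Kmem Γ x (fun c' d' => curv Γ c' d' p q x) := by
  intro x hx
  have first : ∀ a b c d p q : Fin n,
      ∑ e, (curv Γ a b e c x * curv Γ d e p q x - curv Γ a b e d x * curv Γ c e p q x)
        = ∑ e, (curv Γ a b e q x * curv Γ c d p e x - curv Γ c d e q x * curv Γ a b p e x) := by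
    intro a b c d p q
    have h := derivAct_curv_curv_eq_zero hU hΓsmooth hlocsym hx a b c d p q
    simp only [derivAct, Matrix.of_apply] at h
    have hflip : ∑ e, curv Γ a b e c x * curv Γ e d p q x
        = - ∑ e, curv Γ a b e c x * curv Γ d e p q x := by
      rw [← Finset.sum_neg_distrib]
      exact Finset.sum_congr rfl fun e _ => by rw [curv_antisymm Γ e d]; ring
    simp only [Finset.sum_sub_distrib, mul_comm (curv Γ c d _ q x)]
    linarith
  have second : ∀ a b c d p q : Fin n,
      ∑ e, (curv Γ a b e c x * curv Γ d e p q x - curv Γ a b e d x * curv Γ c e p q x +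
        curv Γ c d e a x * curv Γ b e p q x - curv Γ c d e b x * curv Γ a e p q x) = 0 := by
    intro a b c d p q
    have h₁ := first a b c d p q
    have h₂ := first c d a b p q
    simp only [Finset.sum_sub_distrib, Finset.sum_add_distrib] at h₁ h₂ ⊢
    linarith
  exact fun a b c d p q => ⟨first a b c d p q, second a b c d p q,
    fun c' d' => curv_antisymm Γ c' d' p q x, fun a' b' c' d' => second a' b' c' d' p q⟩

end
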